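/- Every finite relative simplicial complex becomes Morse shellable after a single barycentric subdivision: for every finite simplicial complex K and every subcomplex L of K containing no facet of K, the relative simplicial complex Sd(K)∖Sd(L) carries a shellable Morse tiling. -/

import Mathlib

open Finset

variable {V : Type*} [DecidableEq V]

/-- A finite simplicial complex: a finite collection of finite sets of vertices
closed under taking subsets. -/
def IsComplex (K : Finset (Finset V)) : Prop :=
  ∀ σ ∈ K, ∀ τ ⊆ σ, τ ∈ K

/-- The set of nonempty faces of the relative simplicial complex `K ∖ L`. -/
def relFaces (K L : Finset (Finset V)) : Finset (Finset V) :=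
  (K \ L).filter (fun τ => τ ≠ ∅)

/-- A set `A` of faces is closed in `S`: every nonempty face of `S` contained in a
member of `A` belongs to `A`. -/
def closedIn (S A : Finset (Finset V)) : Prop :=
  ∀ τ ∈ S, τ ≠ ∅ → ∀ α ∈ A, τ ⊆ α → τ ∈ A

/-- A facet: a maximal face. -/
def IsFacetOf (K : Finset (Finset V)) (θ : Finset V) : Prop :=
  θ ∈ K ∧ ∀ σ ∈ K, θ ⊆ σ → σ = θ

instance (K : Finset (Finset V)) (θ : Finset V) : Decidable (IsFacetOf K θ) :=
  inferInstanceAs (Decidable (θ ∈ K ∧ ∀ σ ∈ K, θ ⊆ σ → σ = θ))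

/-- A ridge: a face of codimension one in every facet containing it. -/
def IsRidgeOf (K : Finset (Finset V)) (θ : Finset V) : Prop :=
  θ ∈ K ∧ ∀ σ, IsFacetOf K σ → θ ⊆ σ → σ.card = θ.card + 1

/-- Stellar subdivision of `K` at the face `θ`, using the new vertex `v`. -/
def stellar (K : Finset (Finset V)) (θ : Finset V) (v : V) : Finset (Finset V) :=
  K.filter (fun σ => ¬ θ ⊆ σ) ∪
    (K.filter (fun ρ => ¬ θ ⊆ ρ ∧ ρ ∪ θ ∈ K)).image (fun ρ => insert v ρ)

/-- Barycentric subdivision: faces are the chains of nonempty faces of `K`. -/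
def barySd (K : Finset (Finset V)) : Finset (Finset (Finset V)) :=
  K.powerset.filter (fun c => ∅ ∉ c ∧ ∀ τ ∈ c, ∀ τ' ∈ c, τ ⊆ τ' ∨ τ' ⊆ τ)

/-- A Morse tile: a simplex `simplex` deprived of the ridges not containing `res`,
together possibly with a Morse face `morse` of higher codimension. -/
structure MorseTile (V : Type*) where
  simplex : Finset V
  res : Finset V
  morse : Option (Finset V)
  simplex_nonempty : simplex.Nonempty
  res_sub : res ⊆ simplex
  morse_res : ∀ μ ∈ morse, res ⊆ μ
  morse_ssub : ∀ μ ∈ morse, μ ⊂ simplex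
  morse_card : ∀ μ ∈ morse, μ.card + 2 ≤ simplex.card

namespace MorseTile

/-- The face set of a Morse tile. -/
def faceSet (T : MorseTile V) : Finset (Finset V) :=
  match T.morse with
  | none => T.simplex.powerset.filter (fun τ => T.res ⊆ τ ∧ τ ≠ ∅)
  | some μ => T.simplex.powerset.filter (fun τ => T.res ⊆ τ ∧ ¬ τ ⊆ μ)

/-- The dimension of a Morse tile. -/
def dim (T : MorseTile V) : ℕ := T.simplex.card - 1

/-- The order of a Morse tile. -/
def order (T : MorseTile V) : ℕ := T.res.card

/-- The index of a (critical) Morse tile. -/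
def index (T : MorseTile V) : ℕ :=
  if T.res = T.simplex then T.simplex.card - 1 else T.res.card

/-- Basic tiles: no Morse face. -/
def IsBasic (T : MorseTile V) : Prop := T.morse = none

/-- Critical tiles: the Morse face equals the restriction set, or the open simplex. -/
def IsCritical (T : MorseTile V) : Prop := T.morse = some T.res ∨ T.res = T.simplex

/-- Tiles allowed in an h-tiling: basic or critical tiles. -/
def IsHTile (T : MorseTile V) : Prop := T.morse = none ∨ T.morse = some T.res

/-- The closed simplex. -/
def IsClosedSimplex (T : MorseTile V) : Prop := T.morse = none ∧ T.res = ∅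

/-- The open simplex. -/
def IsOpenSimplex (T : MorseTile V) : Prop := T.morse = none ∧ T.res = T.simplex

instance (T : MorseTile V) : Decidable T.IsCritical :=
  inferInstanceAs (Decidable (T.morse = some T.res ∨ T.res = T.simplex))

/-- Isomorphism of Morse tiles: a bijection between the underlying simplices mapping
the face set of one onto the face set of the other. -/
def Isom (T T' : MorseTile V) : Prop :=
  ∃ e : V → V, Set.InjOn e (T.simplex : Set V) ∧ T.simplex.image e = T'.simplex ∧
    T.faceSet.image (fun τ => τ.image e) = T'.faceSet

/-- The subcomplex `L_T` of removed faces of a Morse tile. -/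
def removed (T : MorseTile V) : Finset (Finset V) :=
  T.simplex.powerset.filter (fun τ => τ ∉ T.faceSet)

/-- The stellar subdivision of a Morse tile at a face `θ` of its underlying simplex,
as a relative simplicial complex. -/
def stellarSub (T : MorseTile V) (θ : Finset V) (v : V) : Finset (Finset V) :=
  relFaces (stellar T.simplex.powerset θ v) (stellar T.removed θ v)

end MorseTile

/-- The union of the face sets of a list of Morse tiles. -/
def faceUnion (ts : List (MorseTile V)) : Finset (Finset V) :=
  ts.foldr (fun T A => T.faceSet ∪ A) ∅

/-- A Morse tiling of the set `S` of nonempty faces of a relative complex: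
the face sets of the tiles partition `S`, and for every `d` the union of the
face sets of the tiles of dimension at least `d` is closed in `S`. -/
def IsMorseTiling (S : Finset (Finset V)) (ts : List (MorseTile V)) : Prop :=
  ts.Pairwise (fun T T' => Disjoint T.faceSet T'.faceSet) ∧
  faceUnion ts = S ∧
  ∀ d : ℕ, closedIn S (faceUnion (ts.filter (fun T => decide (d ≤ T.dim))))

/-- A Morse shelling: a Morse tiling whose order makes every initial union closed. -/
def IsMorseShelling (S : Finset (Finset V)) (ts : List (MorseTile V)) : Prop :=
  IsMorseTiling S ts ∧ ∀ p : ℕ, closedIn S (faceUnion (ts.take p))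

/-- An h-tiling: a Morse tiling all of whose tiles are basic or critical. -/
def IsHTiling (S : Finset (Finset V)) (ts : List (MorseTile V)) : Prop :=
  IsMorseTiling S ts ∧ ∀ T ∈ ts, T.IsHTile

/-- A shellable (shelled) h-tiling. -/
def IsHShelling (S : Finset (Finset V)) (ts : List (MorseTile V)) : Prop :=
  IsMorseShelling S ts ∧ ∀ T ∈ ts, T.IsHTile

/-- The number of critical tiles of index `k`. -/
def criticalCount (ts : List (MorseTile V)) (k : ℕ) : ℕ :=
  ts.countP (fun T => decide (T.IsCritical ∧ T.index = k))

/-- The total number of critical tiles. -/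
def totalCritical (ts : List (MorseTile V)) : ℕ :=
  ts.countP (fun T => decide T.IsCritical)

/-- The number of tiles of order `k`. -/
def hCount (ts : List (MorseTile V)) (k : ℕ) : ℕ :=
  ts.countP (fun T => decide (T.order = k))

/-- The number of `k`-dimensional faces. -/
def fCount (S : Finset (Finset V)) (k : ℕ) : ℕ :=
  (S.filter (fun τ => τ.card = k + 1)).card

/-- The Euler characteristic of a set of nonempty faces. -/
def eulerChar (S : Finset (Finset V)) : ℤ :=
  ∑ τ ∈ S, (-1 : ℤ) ^ (τ.card - 1)

/-- A pure `n`-dimensional complex: it has an `n`-dimensional face and all its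
facets have dimension `n`. -/
def IsPureDim (n : ℕ) (K : Finset (Finset V)) : Prop :=
  (∃ σ ∈ K, σ.card = n + 1) ∧ ∀ θ, IsFacetOf K θ → θ.card = n + 1

/-- A closed `n`-dimensional pseudo-manifold: a pure `n`-dimensional complex in
which every `(n-1)`-dimensional face is contained in exactly two facets. -/
def IsPseudoManifold (n : ℕ) (K : Finset (Finset V)) : Prop :=
  IsComplex K ∧ IsPureDim n K ∧
  ∀ ρ ∈ K, ρ.card = n → (K.filter (fun σ => IsFacetOf K σ ∧ ρ ⊆ σ)).card = 2

/-- Strong connectedness: any two facets are joined by a sequence of facets in which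
consecutive ones share an `(n-1)`-dimensional face. -/
def StronglyConnected (n : ℕ) (K : Finset (Finset V)) : Prop :=
  ∀ σ σ', IsFacetOf K σ → IsFacetOf K σ' →
    ∃ (m : ℕ) (c : ℕ → Finset V), c 0 = σ ∧ c m = σ' ∧
      (∀ i ≤ m, IsFacetOf K (c i)) ∧
      ∀ i < m, ∃ ρ : Finset V, ρ.card = n ∧ ρ ⊆ c i ∧ ρ ⊆ c (i + 1)

/-- Classical shellability of a finite simplicial complex. -/
def ClassicallyShellable (K : Finset (Finset V)) : Prop :=
  ∃ (N : ℕ) (f : Fin N → Finset V), Function.Injective f ∧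
    (∀ σ, IsFacetOf K σ ↔ ∃ i, f i = σ) ∧
    ∀ p : Fin N, 0 < (p : ℕ) →
      ∃ R : Finset V, R ≠ ∅ ∧ R ⊆ f p ∧
        ∀ τ : Finset V,
          ((τ ≠ ∅ ∧ τ ⊆ f p ∧ ∀ q, q < p → ¬ τ ⊆ f q) ↔ (R ⊆ τ ∧ τ ⊆ f p))

theorem mem_faceUnion {ts : List (MorseTile V)} {c : Finset V} :
    c ∈ faceUnion ts ↔ ∃ T ∈ ts, c ∈ T.faceSet := by
  induction ts with
  | nil => simp [faceUnion]
  | cons T ts ih =>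
    simp only [faceUnion, List.foldr_cons, mem_union, List.exists_mem_cons_iff] at ih ⊢
    rw [ih]

/-- Removing from `[R, F]` the subsets of a proper face `M` of `F` leaves a Morse tile. -/
theorem exists_morseTile {F R M : Finset V} (hR : R ⊆ F) (hM : M ⊂ F) :
    ∃ T : MorseTile V, T.simplex = F ∧
      ∀ c, c ∈ T.faceSet ↔ c ⊆ F ∧ R ⊆ c ∧ ¬ c ⊆ M := by
  have hF : F.Nonempty := by
    obtain ⟨x, hx, -⟩ := exists_of_ssubset hM
    exact ⟨x, hx⟩
  by_cases hRM : R ⊆ M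
  · by_cases hcard : M.card + 2 ≤ F.card
    · refine ⟨⟨F, R, some M, hF, hR, by simpa using hRM, by simpa using hM,
        by simpa using hcard⟩, rfl, fun c => ?_⟩
      simp [MorseTile.faceSet]
    · obtain ⟨x, hx, hxM⟩ := exists_of_ssubset hM
      have hins : insert x M = F := by
        apply eq_of_subset_of_card_le (insert_subset hx hM.subset)
        rw [card_insert_of_notMem hxM]
        omega
      refine ⟨⟨F, insert x R, none, hF, insert_subset hx hR, by simp, by simp, by simp⟩,
        rfl, fun c => ?_⟩
      simp only [MorseTile.faceSet, mem_filter, mem_powerset, insert_subset_iff]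
      constructor
      · rintro ⟨h1, ⟨h2, h3⟩, -⟩
        exact ⟨h1, h3, fun h => hxM (h h2)⟩
      · rintro ⟨h1, h2, h3⟩
        refine ⟨h1, ⟨?_, h2⟩, ?_⟩
        · by_contra hxc
          refine h3 fun y hy => ?_
          have := h1 hy
          rw [← hins, mem_insert] at this
          rcases this with rfl | h
          · exact absurd hy hxc
          · exact h
        · rintro rfl
          exact h3 (empty_subset _)
  · refine ⟨⟨F, R, none, hF, hR, by simp, by simp, by simp⟩, rfl, fun c => ?_⟩
    simp only [MorseTile.faceSet, mem_filter, mem_powerset]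
    constructor
    · rintro ⟨h1, h2, -⟩
      exact ⟨h1, h2, fun h => hRM (h2.trans h)⟩
    · rintro ⟨h1, h2, h3⟩
      refine ⟨h1, h2, ?_⟩
      rintro rfl
      exact h3 (empty_subset _)

/-- A family of tiles covering `S`, ordered by nonincreasing dimension, such that each tile
consists of the faces of its simplex lying in no earlier simplex, is a Morse shelling. -/
theorem exists_isMorseShelling_of_linearOrder {ι : Type*} [Fintype ι] [LinearOrder ι]
    (S : Finset (Finset V)) (T : ι → MorseTile V)
    (hT : ∀ i c, c ∈ (T i).faceSet ↔
      c ∈ S ∧ c ⊆ (T i).simplex ∧ ∀ j < i, ¬ c ⊆ (T j).simplex)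
    (hcov : ∀ c ∈ S, ∃ i, c ⊆ (T i).simplex)
    (hdim : ∀ i j, i ≤ j → (T j).dim ≤ (T i).dim) :
    ∃ ts : List (MorseTile V), IsMorseShelling S ts := by
  have hmin : ∀ c ∈ S, ∀ j, c ⊆ (T j).simplex → ∃ i ≤ j, c ∈ (T i).faceSet := by
    intro c hc j hj
    obtain ⟨i, hi, hi'⟩ := exists_min_image (univ.filter fun i => c ⊆ (T i).simplex) id
      ⟨j, by simpa using hj⟩
    simp only [mem_filter, mem_univ, true_and, id] at hi hi'
    exact ⟨i, hi' j hj, (hT i c).2 ⟨hc, hi, fun k hk hck => (hi' k hck).not_gt hk⟩⟩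
  have hclosed : ∀ J : List ι, (∀ j ∈ J, ∀ i ≤ j, i ∈ J) →
      closedIn S (faceUnion (J.map T)) := by
    intro J hJ c hc _ α hα hcα
    obtain ⟨_, hT', hα⟩ := mem_faceUnion.1 hα
    obtain ⟨j, hj, rfl⟩ := List.mem_map.1 hT'
    obtain ⟨i, hij, hi⟩ := hmin c hc j (hcα.trans ((hT j α).1 hα).2.1)
    exact mem_faceUnion.2 ⟨T i, List.mem_map_of_mem (hJ j hj i hij), hi⟩
  set I : List ι := (univ : Finset ι).sort (· ≤ ·) with hI
  have hmem : ∀ i, i ∈ I := fun i => by simp [hI]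
  have hsort : I.Pairwise (· < ·) := Finset.sortedLT_sort _ |>.pairwise
  refine ⟨I.map T, ⟨?_, ?_, fun d => ?_⟩, fun p => ?_⟩
  · rw [List.pairwise_map]
    refine hsort.imp fun {i j} hij => disjoint_left.2 fun c hci hcj => ?_
    exact ((hT j c).1 hcj).2.2 i hij ((hT i c).1 hci).2.1
  · ext c
    rw [mem_faceUnion]
    constructor
    · rintro ⟨_, hT', hc⟩
      obtain ⟨i, -, rfl⟩ := List.mem_map.1 hT'
      exact ((hT i c).1 hc).1
    · intro hc
      obtain ⟨j, hj⟩ := hcov c hc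
      obtain ⟨i, -, hi⟩ := hmin c hc j hj
      exact ⟨T i, List.mem_map_of_mem (hmem i), hi⟩
  · rw [List.filter_map]
    refine hclosed _ fun j hj i hij => ?_
    simp only [List.mem_filter, Function.comp, decide_eq_true_eq] at hj ⊢
    exact ⟨hmem i, hj.2.trans (hdim i j hij)⟩
  · rw [← List.map_take]
    refine hclosed _ fun j hj i hij => ?_
    have hi := hmem i
    rw [← List.take_append_drop p I, List.mem_append] at hi
    rcases hi with hi | hi
    · exact hi
    · rw [← List.take_append_drop p I, List.pairwise_append] at hsort
      exact absurd (hsort.2.2 j hj i hi) hij.not_gt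

/-- The flag of faces obtained by adding the entries of a list to `A` one at a time. -/
def flagOf (A : Finset V) : List V → Finset (Finset V)
  | [] => ∅
  | x :: l => insert (insert x A) (flagOf (insert x A) l)

theorem subset_of_mem_flagOf {l : List V} {A u : Finset V} (hu : u ∈ flagOf A l) : A ⊆ u := by
  induction l generalizing A with
  | nil => simp [flagOf] at hu
  | cons x l ih =>
    rw [flagOf, mem_insert] at hu
    rcases hu with rfl | hu
    · exact subset_insert _ _
    · exact (subset_insert _ _).trans (ih hu)

theorem mem_of_mem_flagOf_cons {l : List V} {A u : Finset V} {x : V}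
    (hu : u ∈ flagOf A (x :: l)) : x ∈ u := by
  rw [flagOf, mem_insert] at hu
  rcases hu with rfl | hu
  · exact mem_insert_self _ _
  · exact subset_of_mem_flagOf hu (mem_insert_self _ _)

theorem subset_union_of_mem_flagOf {l : List V} {A u : Finset V} (hu : u ∈ flagOf A l) :
    u ⊆ A ∪ l.toFinset := by
  induction l generalizing A with
  | nil => simp [flagOf] at hu
  | cons x l ih =>
    rw [flagOf, mem_insert] at hu
    rw [List.toFinset_cons, union_insert, ← insert_union]
    rcases hu with rfl | hu
    · exact subset_union_left
    · exact ih hu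

theorem union_toFinset_mem_flagOf {l : List V} (A : Finset V) (hl : l ≠ []) :
    A ∪ l.toFinset ∈ flagOf A l := by
  induction l generalizing A with
  | nil => exact absurd rfl hl
  | cons x l ih =>
    rw [flagOf, mem_insert, List.toFinset_cons, union_insert, ← insert_union]
    by_cases h : l = []
    · simp [h]
    · exact Or.inr (ih _ h)

theorem flagOf_isChain {l : List V} {A u v : Finset V} (hu : u ∈ flagOf A l)
    (hv : v ∈ flagOf A l) : u ⊆ v ∨ v ⊆ u := by
  induction l generalizing A with
  | nil => simp [flagOf] at hu
  | cons x l ih =>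
    rw [flagOf, mem_insert] at hu hv
    rcases hu with rfl | hu
    · rcases hv with rfl | hv
      · exact Or.inl subset_rfl
      · exact Or.inl (subset_of_mem_flagOf hv)
    · rcases hv with rfl | hv
      · exact Or.inr (subset_of_mem_flagOf hu)
      · exact ih hu hv

theorem notMem_flagOf {l : List V} {A : Finset V} (hA : ∀ x ∈ l, x ∉ A) : A ∉ flagOf A l := by
  cases l with
  | nil => simp [flagOf]
  | cons x l => exact fun h => hA x (by simp) (mem_of_mem_flagOf_cons h)

theorem notMem_insert_of_nodup_cons {l : List V} {A : Finset V} {x : V} (hl : (x :: l).Nodup)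
    (hA : ∀ y ∈ x :: l, y ∉ A) : ∀ y ∈ l, y ∉ insert x A := by
  intro y hy
  rw [mem_insert, not_or]
  refine ⟨?_, hA y (List.mem_cons_of_mem _ hy)⟩
  rintro rfl
  exact (List.nodup_cons.1 hl).1 hy

theorem card_flagOf {l : List V} {A : Finset V} (hl : l.Nodup) (hA : ∀ x ∈ l, x ∉ A) :
    (flagOf A l).card = l.length := by
  induction l generalizing A with
  | nil => simp [flagOf]
  | cons x l ih =>
    have hA' := notMem_insert_of_nodup_cons hl hA
    rw [flagOf, card_insert_of_notMem (notMem_flagOf hA'), ih (List.nodup_cons.1 hl).2 hA',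
      List.length_cons]

/-- A chain of faces between `A` and `Θ` extends to a complete flag. -/
theorem exists_subset_flagOf {Θ : Finset V} {n : ℕ} {A : Finset V} {c : Finset (Finset V)}
    (hn : (Θ \ A).card = n) (hA : A ⊆ Θ) (hc : ∀ u ∈ c, A ⊂ u ∧ u ⊆ Θ)
    (hchain : ∀ u ∈ c, ∀ v ∈ c, u ⊆ v ∨ v ⊆ u) :
    ∃ l : List V, l.Nodup ∧ (∀ x ∈ l, x ∉ A) ∧ A ∪ l.toFinset = Θ ∧ c ⊆ flagOf A l := by
  induction n generalizing A c with
  | zero =>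
    have hΘ : Θ ⊆ A := by simpa using hn
    refine ⟨[], by simp, by simp, by simpa using hA.antisymm hΘ, fun u hu => ?_⟩
    exact absurd ((hc u hu).2.trans hΘ) (hc u hu).1.2
  | succ n ih =>
    obtain ⟨x, hxΘ, hxA, hxc⟩ : ∃ x ∈ Θ, x ∉ A ∧ ∀ u ∈ c, x ∈ u := by
      rcases c.eq_empty_or_nonempty with rfl | hne
      · obtain ⟨x, hx⟩ := card_pos.1 (by omega : 0 < (Θ \ A).card)
        rw [mem_sdiff] at hx
        exact ⟨x, hx.1, hx.2, by simp⟩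
      · obtain ⟨m, hm, hmin⟩ := exists_min_image c card hne
        obtain ⟨x, hxm, hxA⟩ := exists_of_ssubset (hc m hm).1
        refine ⟨x, (hc m hm).2 hxm, hxA, fun u hu => ?_⟩
        rcases hchain m hm u hu with h | h
        · exact h hxm
        · rwa [eq_of_subset_of_card_le h (hmin u hu)]
    obtain ⟨l, hl, hlA, hlΘ, hcl⟩ := ih (A := insert x A) (c := c.erase (insert x A))
      (by rw [sdiff_insert, card_erase_of_mem (by simp [hxΘ, hxA]), hn]; rfl)
      (insert_subset hxΘ hA)
      (fun u hu => by
        rw [mem_erase] at hu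
        exact ⟨(insert_subset (hxc u hu.2) (hc u hu.2).1.1).ssubset_of_ne hu.1.symm,
          (hc u hu.2).2⟩)
      (fun u hu v hv => hchain u (mem_of_mem_erase hu) v (mem_of_mem_erase hv))
    refine ⟨x :: l, List.nodup_cons.2 ⟨fun h => hlA x h (mem_insert_self _ _), hl⟩, ?_, ?_, ?_⟩
    · intro y hy
      rcases List.mem_cons.1 hy with rfl | hy
      · exact hxA
      · exact fun h => hlA y hy (mem_insert_of_mem h)
    · rw [List.toFinset_cons, union_insert, ← insert_union, hlΘ]
    · intro u hu
      rw [flagOf, mem_insert]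
      by_cases h : u = insert x A
      · exact Or.inl h
      · exact Or.inr (hcl (mem_erase.2 ⟨h, hu⟩))

section LinearOrder

variable {α : Type*} [LinearOrder α]

/-- If some entry after the head `x` is smaller than `x` and is contained in every member of `c`
containing `x`, then some descent of the list lies outside of `c`. -/
theorem exists_lt_flagOf_of_head {t : List α} {x y : α} {A : Finset α} {c : Finset (Finset α)}
    (hl : (x :: t).Nodup) (hA : ∀ z ∈ x :: t, z ∉ A) (hy : y ∈ t) (hyx : y < x)
    (hc : ∀ u ∈ c, x ∈ u → y ∈ u) (hcl : c ⊆ flagOf A (x :: t)) :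
    ∃ l, l.Perm (x :: t) ∧ l < x :: t ∧ ∃ u ∈ flagOf A (x :: t), u ∉ c ∧
      (flagOf A (x :: t)).erase u ⊆ flagOf A l := by
  induction t generalizing x A c with
  | nil => simp at hy
  | cons z t ih =>
    rcases lt_or_ge z x with hzx | hxz
    · refine ⟨z :: x :: t, List.Perm.swap _ _ _, List.cons_lt_cons_iff.2 (Or.inl hzx),
        insert x A, mem_insert_self _ _, fun h => ?_, ?_⟩
      · have := hc _ h (mem_insert_self _ _)
        rw [mem_insert] at this
        exact this.elim hyx.ne (hA y (List.mem_cons_of_mem _ hy))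
      · intro u hu
        simp only [flagOf, mem_erase, mem_insert] at hu ⊢
        rw [insert_comm x z A]
        tauto
    · have hyt : y ∈ t := (List.mem_cons.1 hy).resolve_left (hyx.trans_le hxz).ne
      have hA' := notMem_insert_of_nodup_cons hl hA
      obtain ⟨l, hlp, hlt, u, hu, huc, hsub⟩ := ih (x := z) (A := insert x A)
        (c := c.erase (insert x A)) (List.nodup_cons.1 hl).2 hA' hyt (hyx.trans_le hxz)
        (fun u hu _ => hc u (mem_of_mem_erase hu)
          (mem_of_mem_flagOf_cons (hcl (mem_of_mem_erase hu))))
        (fun u hu => (mem_insert.1 (hcl (mem_of_mem_erase hu))).resolve_left (ne_of_mem_erase hu))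
      have hne : u ≠ insert x A := fun h => notMem_flagOf hA' (h ▸ hu)
      refine ⟨x :: l, hlp.cons x, List.cons_lt_cons_iff.2 (Or.inr ⟨rfl, hlt⟩), u,
        mem_insert_of_mem hu, fun h => huc (mem_erase.2 ⟨hne, h⟩), ?_⟩
      rw [flagOf, erase_insert_of_ne hne.symm]
      exact insert_subset_insert _ hsub

/-- The lexicographic order on the flags of a simplex is a shelling: a face shared with an earlier
flag lies in a ridge shared with an earlier flag. -/
theorem exists_lt_flagOf {l l' : List α} {A : Finset α} {c : Finset (Finset α)}
    (hl : l.Nodup) (hA : ∀ z ∈ l, z ∉ A) (hp : l'.Perm l) (hlt : l' < l)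
    (hc : c ⊆ flagOf A l) (hc' : c ⊆ flagOf A l') :
    ∃ l'', l''.Perm l ∧ l'' < l ∧ ∃ u ∈ flagOf A l, u ∉ c ∧
      (flagOf A l).erase u ⊆ flagOf A l'' := by
  induction l generalizing l' A c with
  | nil => simp at hlt
  | cons x t ih =>
    cases l' with
    | nil => simp at hp
    | cons y t' =>
      rcases List.cons_lt_cons_iff.1 hlt with hyx | ⟨rfl, hlt'⟩
      · exact exists_lt_flagOf_of_head hl hA
          ((List.mem_cons.1 (hp.mem_iff.1 List.mem_cons_self)).resolve_left hyx.ne) hyx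
          (fun u hu _ => mem_of_mem_flagOf_cons (hc' hu)) hc
      · have hA' := notMem_insert_of_nodup_cons hl hA
        obtain ⟨l, hlp, hlt, u, hu, huc, hsub⟩ := ih (A := insert y A)
          (c := c.erase (insert y A)) (List.nodup_cons.1 hl).2 hA' (List.perm_cons _ |>.1 hp) hlt'
          (fun u hu => (mem_insert.1 (hc (mem_of_mem_erase hu))).resolve_left
            (ne_of_mem_erase hu))
          (fun u hu => (mem_insert.1 (hc' (mem_of_mem_erase hu))).resolve_left
            (ne_of_mem_erase hu))
        have hne : u ≠ insert y A := fun h => notMem_flagOf hA' (h ▸ hu)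
        refine ⟨y :: l, hlp.cons y, List.cons_lt_cons_iff.2 (Or.inr ⟨rfl, hlt⟩), u,
          mem_insert_of_mem hu, fun h => huc (mem_erase.2 ⟨hne, h⟩), ?_⟩
        rw [flagOf, erase_insert_of_ne hne.symm]
        exact insert_subset_insert _ hsub

/-- The key ordering the complete flags: first by decreasing dimension, then by the facet they
fill, then lexicographically. -/
def facetKey (Θ : Finset α) : ℕᵒᵈ ×ₗ List α :=
  toLex (OrderDual.toDual Θ.card, Θ.sort (· ≤ ·))

theorem facetKey_injective : Function.Injective (facetKey (α := α)) := by
  intro Θ Θ' h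
  have h2 : Θ.sort (· ≤ ·) = Θ'.sort (· ≤ ·) := congrArg (fun p => (ofLex p).2) h
  rw [← Finset.sort_toFinset Θ (· ≤ ·), h2, Finset.sort_toFinset]

theorem card_le_of_facetKey_le {Θ Θ' : Finset α} (h : facetKey Θ ≤ facetKey Θ') :
    Θ'.card ≤ Θ.card := by
  rcases Prod.Lex.toLex_le_toLex.1 h with h | h
  · exact OrderDual.toDual_lt_toDual.1 h |>.le
  · exact (OrderDual.toDual_inj.1 h.1).ge

/-- An ordering of the vertices of a nonempty facet. -/
@[ext]
structure FacetOrdering (K : Finset (Finset α)) where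
  list : List α
  nodup : list.Nodup
  isFacet : IsFacetOf K list.toFinset
  ne_nil : list ≠ []

instance (K : Finset (Finset α)) : Finite (FacetOrdering K) := by
  refine Finite.of_injective (β := K.biUnion fun Θ => Θ.toList.permutations.toFinset)
    (fun l => ⟨l.list, ?_⟩) fun l l' h => FacetOrdering.ext (congrArg Subtype.val h)
  simp only [mem_biUnion, List.mem_toFinset, List.mem_permutations]
  exact ⟨_, l.isFacet.1, (List.toFinset_toList l.nodup).symm⟩

theorem exists_isMorseShelling_barySd (K L : Finset (Finset α)) (hK : IsComplex K)
    (hL : IsComplex L) (hfac : ∀ σ, IsFacetOf K σ → σ ∉ L) :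
    ∃ ts : List (MorseTile (Finset α)), IsMorseShelling (relFaces (barySd K) (barySd L)) ts := by
  set S := relFaces (barySd K) (barySd L) with hS
  have hmemS : ∀ c, c ∈ S ↔ c ⊆ K ∧ ∅ ∉ c ∧ (∀ u ∈ c, ∀ v ∈ c, u ⊆ v ∨ v ⊆ u) ∧
      ¬ c ⊆ L ∧ c ≠ ∅ := by
    intro c
    simp only [hS, relFaces, barySd, mem_filter, mem_sdiff, mem_powerset]
    tauto
  let ι := FacetOrdering K
  let : Fintype ι := Fintype.ofFinite ι
  let key : ι → (ℕᵒᵈ ×ₗ List α) ×ₗ List α := fun l => toLex (facetKey l.list.toFinset, l.list)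
  have hkey : Function.Injective key := fun l l' h =>
    FacetOrdering.ext (congrArg (fun p => (ofLex p).2) h)
  let : LinearOrder ι := LinearOrder.lift' key hkey
  have hlt : ∀ l l' : ι, l < l' ↔ facetKey l.list.toFinset < facetKey l'.list.toFinset ∨
      l.list.toFinset = l'.list.toFinset ∧ l.list < l'.list := by
    intro l l'
    rw [← facetKey_injective.eq_iff]
    exact Prod.Lex.toLex_lt_toLex (x := (facetKey l.list.toFinset, l.list))
      (y := (facetKey l'.list.toFinset, l'.list))
  let F : ι → Finset (Finset α) := fun l => flagOf ∅ l.list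
  have hFle : ∀ l : ι, ∀ u ∈ F l, u ⊆ l.list.toFinset := fun l u hu => by
    simpa using subset_union_of_mem_flagOf hu
  have hFtop : ∀ l : ι, l.list.toFinset ∈ F l := fun l => by
    simpa using union_toFinset_mem_flagOf ∅ l.ne_nil
  have hFcard : ∀ l : ι, (F l).card = l.list.toFinset.card := fun l => by
    rw [card_flagOf l.nodup (by simp), List.toFinset_card_of_nodup l.nodup]
  have hext : ∀ c : Finset (Finset α), ∅ ∉ c → (∀ u ∈ c, ∀ v ∈ c, u ⊆ v ∨ v ⊆ u) → c ≠ ∅ →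
      ∀ Θ, IsFacetOf K Θ → (∀ u ∈ c, u ⊆ Θ) → ∃ l : ι, l.list.toFinset = Θ ∧ c ⊆ F l := by
    intro c h0 hch hne Θ hΘ hcΘ
    obtain ⟨l, hl, -, hlΘ, hcl⟩ := exists_subset_flagOf (A := ∅) rfl (empty_subset Θ)
      (fun u hu => ⟨empty_ssubset.2 (nonempty_iff_ne_empty.2 fun h => h0 (h ▸ hu)), hcΘ u hu⟩) hch
    rw [empty_union] at hlΘ
    refine ⟨⟨l, hl, hlΘ ▸ hΘ, ?_⟩, hlΘ, hcl⟩
    rintro rfl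
    exact hne (subset_empty.1 hcl)
  have htop : ∀ c : Finset (Finset α), (∀ u ∈ c, ∀ v ∈ c, u ⊆ v ∨ v ⊆ u) → c ≠ ∅ →
      ∃ m ∈ c, ∀ u ∈ c, u ⊆ m := by
    intro c hch hne
    obtain ⟨m, hm, hmax⟩ := exists_max_image c card (nonempty_iff_ne_empty.2 hne)
    refine ⟨m, hm, fun u hu => ?_⟩
    rcases hch u hu m hm with h | h
    · exact h
    · exact (eq_of_subset_of_card_le h (hmax u hu)).ge
  have htile : ∀ l : ι, ∃ T : MorseTile (Finset α), T.simplex = F l ∧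
      ∀ c, c ∈ T.faceSet ↔ c ∈ S ∧ c ⊆ F l ∧ ∀ l' < l, ¬ c ⊆ F l' := by
    classical
    intro l
    let R := (F l).filter fun u => ∃ l' : ι, l'.list.toFinset = l.list.toFinset ∧ l'.list < l.list ∧
      (F l).erase u ⊆ F l'
    let M := (F l).filter fun u => u ∈ L ∨ ∃ l' : ι,
      facetKey l'.list.toFinset < facetKey l.list.toFinset ∧ u ⊆ l'.list.toFinset
    have hM : M ⊂ F l := by
      refine (filter_subset _ _).ssubset_of_ne fun h => ?_
      have := hFtop l
      rw [← h, mem_filter] at this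
      rcases this.2 with h | ⟨l', hl', hsub⟩
      · exact hfac _ l.isFacet h
      · rw [l.isFacet.2 _ l'.isFacet.1 hsub] at hl'
        exact lt_irrefl _ hl'
    obtain ⟨T, hT, hTc⟩ := exists_morseTile (R := R) (filter_subset _ _) hM
    refine ⟨T, hT, fun c => ?_⟩
    rw [hTc]
    constructor
    · rintro ⟨hcF, hRc, hcM⟩
      refine ⟨(hmemS c).2 ⟨fun u hu => hK _ l.isFacet.1 _ (hFle l u (hcF hu)), fun h => ?_,
        fun u hu v hv => flagOf_isChain (hcF hu) (hcF hv), fun h => ?_, ?_⟩, hcF, ?_⟩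
      · exact notMem_flagOf (by simp) (hcF h)
      · exact hcM fun u hu => mem_filter.2 ⟨hcF hu, Or.inl (h hu)⟩
      · rintro rfl
        exact hcM (empty_subset _)
      · intro l' hl' hcl'
        rcases (hlt _ _).1 hl' with h | ⟨hΘ, h⟩
        · exact hcM fun u hu => mem_filter.2 ⟨hcF hu, Or.inr ⟨l', h, hFle l' u (hcl' hu)⟩⟩
        · obtain ⟨l'', hp, hl'', u, hu, huc, hsub⟩ := exists_lt_flagOf l.nodup (by simp)
            (List.perm_of_nodup_nodup_toFinset_eq l'.nodup l.nodup hΘ) h hcF hcl'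
          have hΘ'' : l''.toFinset = l.list.toFinset := List.toFinset_eq_of_perm _ _ hp
          refine huc (hRc (mem_filter.2 ⟨hu, ⟨l'', hp.nodup_iff.2 l.nodup, ?_, ?_⟩, hΘ'', hl'', hsub⟩))
          · rw [hΘ'']
            exact l.isFacet
          · rintro rfl
            exact l.ne_nil hp.symm.eq_nil
    · rintro ⟨hcS, hcF, hold⟩
      obtain ⟨-, h0, hch, hcL, hne⟩ := (hmemS c).1 hcS
      refine ⟨hcF, fun u hu => ?_, fun hcM => ?_⟩
      · obtain ⟨-, l', hΘ, hl', hsub⟩ := mem_filter.1 hu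
        by_contra huc
        exact hold l' ((hlt _ _).2 (Or.inr ⟨hΘ, hl'⟩)) fun v hv =>
          hsub (mem_erase.2 ⟨fun h => huc (h ▸ hv), hcF hv⟩)
      · obtain ⟨m, hm, hmax⟩ := htop c hch hne
        rcases (mem_filter.1 (hcM hm)).2 with h | ⟨l', hl', hsub⟩
        · exact hcL fun u hu => hL m h u (hmax u hu)
        · obtain ⟨l'', hΘ, hc''⟩ := hext c h0 hch hne _ l'.isFacet
            fun u hu => (hmax u hu).trans hsub
          exact hold l'' ((hlt _ _).2 (Or.inl (hΘ ▸ hl'))) hc''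
  choose T hTF hT using htile
  refine exists_isMorseShelling_of_linearOrder S T (fun l c => ?_) (fun c hc => ?_) ?_
  · simp only [hTF]
    exact hT l c
  · obtain ⟨hcK, h0, hch, -, hne⟩ := (hmemS c).1 hc
    obtain ⟨m, hm, hmax⟩ := htop c hch hne
    obtain ⟨Θ, hmΘ, hΘ⟩ := K.exists_le_maximal (hcK hm)
    obtain ⟨l, -, hl⟩ := hext c h0 hch hne Θ
      ⟨hΘ.1, fun σ hσ h => (hΘ.2 hσ h).antisymm h⟩ fun u hu => (hmax u hu).trans hmΘ
    exact ⟨l, by rwa [hTF]⟩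
  · intro l l' hll'
    simp only [MorseTile.dim, hTF, hFcard]
    refine Nat.sub_le_sub_right ?_ 1
    rcases hll'.lt_or_eq with h | rfl
    · rcases (hlt _ _).1 h with h | ⟨h, -⟩
      · exact card_le_of_facetKey_le h.le
      · rw [h]
    · exact le_rfl

end LinearOrder

/-- every finite relative simplicial complex becomes Morse shellable
after a single barycentric subdivision. -/
theorem barycentric_subdivision_morse_shellable {V : Type*} [DecidableEq V]
    (K L : Finset (Finset V))
    (hK : IsComplex K) (hL : IsComplex L) (hLK : L ⊆ K)
    (hfac : ∀ σ, IsFacetOf K σ → σ ∉ L) :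
    ∃ ts : List (MorseTile (Finset V)),
      IsMorseShelling (relFaces (barySd K) (barySd L)) ts := by
  obtain ⟨lin⟩ : Nonempty (LinearOrder V) := by
    classical
    exact ⟨linearOrderOfSTO WellOrderingRel⟩
  obtain rfl : ‹DecidableEq V› = lin.toDecidableEq := Subsingleton.elim _ _
  exact exists_isMorseShelling_barySd K L hK hL hfac
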